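/- arXiv:2102.00231 — 7 statements merged into one kernel-verified Lean document; each statement's English description precedes it below -/
import Mathlib

section
/- Fix d ∈ (0,1) and define g^M(ω) = ω(d + d² − 3dω + ω²)/(d² + (1 − 2d)ω). Then 0 ≤ g^M(ω) ≤ 1 for every ω ∈ [0,1]. -/
/-- The WENO-M mapping function of Henrick et al. -/
noncomputable def gM (d ω : ℝ) : ℝ :=
  ω * (d + d ^ 2 - 3 * d * ω + ω ^ 2) / (d ^ 2 + (1 - 2 * d) * ω)

theorem gM_denom_pos {d ω : ℝ} (hd0 : 0 < d) (hd1 : d < 1) (h0 : 0 ≤ ω) (h1 : ω ≤ 1) :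
    0 < d ^ 2 + (1 - 2 * d) * ω := by
  have hd : 0 < 1 - d := sub_pos.2 hd1
  have key : d ^ 2 + (1 - 2 * d) * ω = d ^ 2 * (1 - ω) + (1 - d) ^ 2 * ω := by ring
  rw [key]
  rcases h0.eq_or_lt with rfl | hpos
  · simpa using pow_pos hd0 2
  · have := mul_nonneg (sq_nonneg d) (sub_nonneg.2 h1)
    positivity

theorem gM_quadratic_nonneg {d ω : ℝ} (hd : 0 ≤ d) (h1 : ω ≤ 1) :
    0 ≤ d + d ^ 2 - 3 * d * ω + ω ^ 2 := by
  have key : d + d ^ 2 - 3 * d * ω + ω ^ 2 = (ω - d) ^ 2 + d * (1 - ω) := by ring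
  rw [key]
  exact add_nonneg (sq_nonneg _) (mul_nonneg hd (sub_nonneg.2 h1))

theorem gM_range (d : ℝ) (hd0 : 0 < d) (hd1 : d < 1) :
    ∀ ω ∈ Set.Icc (0 : ℝ) 1, 0 ≤ gM d ω ∧ gM d ω ≤ 1 := by
  rintro ω ⟨h0, h1⟩
  have hD := gM_denom_pos hd0 hd1 h0 h1
  refine ⟨div_nonneg (mul_nonneg h0 (gM_quadratic_nonneg hd0.le h1)) hD.le, ?_⟩
  rw [gM, div_le_one hD]
  have h := mul_nonneg (sub_nonneg.2 h1)
    (gM_quadratic_nonneg (sub_nonneg.2 hd1.le) (sub_le_self 1 h0))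
  linear_combination h
end

section
/- Fix d ∈ (0,1) and define g^M(ω) = ω(d + d² − 3dω + ω²)/(d² + (1 − 2d)ω). Then the first derivative of g^M at ω = d equals 0 and the second derivative of g^M at ω = d equals 0. -/
theorem gM_eq_add_div {d ω : ℝ} (h : d ^ 2 + (1 - 2 * d) * ω ≠ 0) :
    gM d ω = d + (ω - d) ^ 3 / (d ^ 2 + (1 - 2 * d) * ω) := by
  rw [gM, ← sub_eq_iff_eq_add', div_sub' h]
  ring

theorem eventually_gM_denom_ne_zero {d ω : ℝ} (h : d ^ 2 + (1 - 2 * d) * ω ≠ 0) :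
    ∀ᶠ x in nhds ω, d ^ 2 + (1 - 2 * d) * x ≠ 0 :=
  ContinuousAt.eventually_ne (by fun_prop) h

theorem hasDerivAt_gM_denom (d ω : ℝ) :
    HasDerivAt (fun x : ℝ ↦ d ^ 2 + (1 - 2 * d) * x) (1 - 2 * d) ω := by
  simpa using ((hasDerivAt_id ω).const_mul (1 - 2 * d)).const_add (d ^ 2)

theorem hasDerivAt_gM {d ω : ℝ} (h : d ^ 2 + (1 - 2 * d) * ω ≠ 0) :
    HasDerivAt (gM d)
      ((ω - d) ^ 2 * ((3 * (d ^ 2 + (1 - 2 * d) * ω) - (ω - d) * (1 - 2 * d)) /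
        (d ^ 2 + (1 - 2 * d) * ω) ^ 2)) ω := by
  have hnum : HasDerivAt (fun x : ℝ ↦ (x - d) ^ 3) (3 * (ω - d) ^ 2) ω := by
    simpa using ((hasDerivAt_id ω).sub_const d).fun_pow 3
  have hquot := (hnum.div (hasDerivAt_gM_denom d ω) h).const_add d
  refine (hquot.congr_of_eventuallyEq ?_).congr_deriv (by ring)
  filter_upwards [eventually_gM_denom_ne_zero h] with x hx using gM_eq_add_div hx

theorem gM_deriv_at_d (d : ℝ) (hd0 : 0 < d) (hd1 : d < 1) :
    deriv (gM d) d = 0 ∧ iteratedDeriv 2 (gM d) d = 0 := by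
  have h : d ^ 2 + (1 - 2 * d) * d ≠ 0 := by
    have := mul_pos hd0 (sub_pos.2 hd1)
    nlinarith
  refine ⟨by simpa using (hasDerivAt_gM h).deriv, ?_⟩
  rw [iteratedDeriv_succ, iteratedDeriv_one]
  have hderiv : deriv (gM d) =ᶠ[nhds d] fun ω ↦
      (ω - d) ^ 2 * ((3 * (d ^ 2 + (1 - 2 * d) * ω) - (ω - d) * (1 - 2 * d)) /
        (d ^ 2 + (1 - 2 * d) * ω) ^ 2) := by
    filter_upwards [eventually_gM_denom_ne_zero h] with ω hω using (hasDerivAt_gM hω).deriv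
  have hsq : HasDerivAt (fun x : ℝ ↦ (x - d) ^ 2) 0 d := by
    simpa using ((hasDerivAt_id d).sub_const d).fun_pow 2
  have hfactor : DifferentiableAt ℝ (fun ω : ℝ ↦
      (3 * (d ^ 2 + (1 - 2 * d) * ω) - (ω - d) * (1 - 2 * d)) /
        (d ^ 2 + (1 - 2 * d) * ω) ^ 2) d :=
    DifferentiableAt.div (by fun_prop) (by fun_prop) (pow_ne_zero 2 h)
  rw [hderiv.deriv_eq]
  simpa using (hsq.fun_mul hfactor.hasDerivAt).deriv
end

section
/- Fix d ∈ (0,1) and define g^M(ω) = ω(d + d² − 3dω + ω²)/(d² + (1 − 2d)ω). Then there exists a constant C > 0 such that |g^M(ω) − d| ≤ C·|ω − d|³ for all ω ∈ [0,1]. -/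
/-- The error of the mapping at `d` is an exact cube over the denominator. -/
theorem gM_sub_eq {d ω : ℝ} (h : d ^ 2 + (1 - 2 * d) * ω ≠ 0) :
    gM d ω - d = (ω - d) ^ 3 / (d ^ 2 + (1 - 2 * d) * ω) := by
  rw [gM, div_sub' h]
  congr 1
  ring

/-- The denominator is the convex combination `(1 - ω) d² + ω (1 - d)²`, hence bounded below. -/
theorem le_gM_denom {d ω : ℝ} (hd0 : 0 ≤ d) (hd1 : d ≤ 1) (hω : ω ∈ Set.Icc (0 : ℝ) 1) :
    d ^ 2 * (1 - d) ^ 2 ≤ d ^ 2 + (1 - 2 * d) * ω := by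
  have h₁ : d ^ 2 * (1 - d) ^ 2 ≤ d ^ 2 :=
    mul_le_of_le_one_right (sq_nonneg d) (pow_le_one₀ (by linarith) (by linarith))
  have h₂ : d ^ 2 * (1 - d) ^ 2 ≤ (1 - d) ^ 2 :=
    mul_le_of_le_one_left (sq_nonneg _) (pow_le_one₀ hd0 hd1)
  have h₃ := mul_le_mul_of_nonneg_left h₁ (sub_nonneg.2 hω.2)
  have h₄ := mul_le_mul_of_nonneg_left h₂ hω.1
  linarith

theorem gM_third_order_contact (d : ℝ) (hd0 : 0 < d) (hd1 : d < 1) :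
    ∃ C > 0, ∀ ω ∈ Set.Icc (0 : ℝ) 1, |gM d ω - d| ≤ C * |ω - d| ^ 3 := by
  have hm : 0 < d ^ 2 * (1 - d) ^ 2 := mul_pos (pow_pos hd0 2) (pow_pos (sub_pos.2 hd1) 2)
  refine ⟨(d ^ 2 * (1 - d) ^ 2)⁻¹, inv_pos.2 hm, fun ω hω => ?_⟩
  have hle := le_gM_denom hd0.le hd1.le hω
  have hpos := hm.trans_le hle
  rw [gM_sub_eq hpos.ne', abs_div, abs_pow, abs_of_pos hpos, div_eq_inv_mul]
  gcongr
end

section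
/- Fix d ∈ (0,1) and an integer k ≥ 2, and let g^PM be the piecewise polynomial WENO-PM mapping function. Then g^PM is monotone nondecreasing on the interval [0,1]. -/
/-- The left polynomial piece of the WENO-PM mapping function. -/
noncomputable def pL (d : ℝ) (k : ℕ) (ω : ℝ) : ℝ :=
  (-1 : ℝ) ^ k * (((k : ℝ) + 1) / d ^ (k + 1)) * (ω - d) ^ (k + 1) * (ω + d / ((k : ℝ) + 1)) + d

/-- The right polynomial piece of the WENO-PM mapping function. -/
noncomputable def pR (d : ℝ) (k : ℕ) (ω : ℝ) : ℝ :=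
  -(((k : ℝ) + 1) / (1 - d) ^ (k + 1)) * (ω - d) ^ (k + 1) *
    (ω + (d - ((k : ℝ) + 2)) / ((k : ℝ) + 1)) + d

/-- The WENO-PM mapping function of Feng et al. -/
noncomputable def gPM (d : ℝ) (k : ℕ) (ω : ℝ) : ℝ :=
  if ω ≤ d then pL d k ω else pR d k ω

/-- The normalized profile `t ^ (k + 1) * ((k + 2) - (k + 1) * t)`: both pieces of the WENO-PM
mapping are affine rescalings of it. -/
def pmProfile (k : ℕ) (t : ℝ) : ℝ :=
  t ^ (k + 1) * (((k : ℝ) + 2) - ((k : ℝ) + 1) * t)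

theorem hasDerivAt_pmProfile (k : ℕ) (t : ℝ) :
    HasDerivAt (pmProfile k) (((k : ℝ) + 1) * ((k : ℝ) + 2) * t ^ k * (1 - t)) t := by
  have h := (hasDerivAt_pow (k + 1) t).mul
    (((hasDerivAt_id t).const_mul ((k : ℝ) + 1)).const_sub ((k : ℝ) + 2))
  refine h.congr_deriv ?_
  simp only [Nat.add_sub_cancel, id]
  push_cast
  ring

theorem monotoneOn_pmProfile (k : ℕ) : MonotoneOn (pmProfile k) (Set.Icc 0 1) := by
  refine monotoneOn_of_deriv_nonneg (convex_Icc 0 1)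
    (fun t _ => (hasDerivAt_pmProfile k t).continuousAt.continuousWithinAt)
    (fun t _ => (hasDerivAt_pmProfile k t).differentiableAt.differentiableWithinAt) ?_
  intro t ht
  rw [interior_Icc] at ht
  rw [(hasDerivAt_pmProfile k t).deriv]
  have h0 : 0 ≤ t := ht.1.le
  have h1 : 0 ≤ 1 - t := sub_nonneg.2 ht.2.le
  positivity

theorem pmProfile_nonneg (k : ℕ) {t : ℝ} (ht : t ∈ Set.Icc (0 : ℝ) 1) : 0 ≤ pmProfile k t := by
  simpa [pmProfile] using
    monotoneOn_pmProfile k (Set.left_mem_Icc.2 zero_le_one) ht ht.1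

theorem pL_eq_pmProfile {d : ℝ} (hd : d ≠ 0) (k : ℕ) (ω : ℝ) :
    pL d k ω = d - d * pmProfile k ((d - ω) / d) := by
  have hk : (k : ℝ) + 1 ≠ 0 := by positivity
  have hsign : (-1 : ℝ) ^ k * (ω - d) ^ (k + 1) = -(d - ω) ^ (k + 1) := by
    rw [← neg_sub d ω, neg_pow (d - ω), ← mul_assoc, ← pow_add,
      Odd.neg_one_pow ⟨k, by ring⟩, neg_one_mul]
  calc pL d k ω
      = (((k : ℝ) + 1) / d ^ (k + 1)) * ((-1 : ℝ) ^ k * (ω - d) ^ (k + 1)) *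
          (ω + d / ((k : ℝ) + 1)) + d := by rw [pL]; ring
    _ = d - d * pmProfile k ((d - ω) / d) := by
      rw [hsign, pmProfile, div_pow]
      field_simp
      ring

theorem pR_eq_pmProfile {d : ℝ} (hd : 1 - d ≠ 0) (k : ℕ) (ω : ℝ) :
    pR d k ω = d + (1 - d) * pmProfile k ((ω - d) / (1 - d)) := by
  have hk : (k : ℝ) + 1 ≠ 0 := by positivity
  rw [pR, pmProfile, div_pow]
  field_simp
  ring

theorem gPM_monotone (d : ℝ) (hd0 : 0 < d) (hd1 : d < 1) (k : ℕ) (hk : 2 ≤ k) :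
    MonotoneOn (gPM d k) (Set.Icc (0 : ℝ) 1) := by
  have he : 0 < 1 - d := sub_pos.2 hd1
  have hleft {x : ℝ} (hx : 0 ≤ x) (hxd : x ≤ d) : (d - x) / d ∈ Set.Icc (0 : ℝ) 1 :=
    ⟨div_nonneg (sub_nonneg.2 hxd) hd0.le, (div_le_one hd0).2 (by linarith)⟩
  have hright {x : ℝ} (hx : x ≤ 1) (hdx : d ≤ x) : (x - d) / (1 - d) ∈ Set.Icc (0 : ℝ) 1 :=
    ⟨div_nonneg (sub_nonneg.2 hdx) he.le, (div_le_one he).2 (by linarith)⟩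
  intro x hx y hy hxy
  simp only [gPM, pL_eq_pmProfile hd0.ne', pR_eq_pmProfile he.ne']
  split_ifs with hxd hyd hyd
  · have := monotoneOn_pmProfile k (hleft hy.1 hyd) (hleft hx.1 hxd) (by gcongr)
    gcongr
  · have h1 := mul_nonneg hd0.le (pmProfile_nonneg k (hleft hx.1 hxd))
    have h2 := mul_nonneg he.le (pmProfile_nonneg k (hright hy.2 (not_le.1 hyd).le))
    linarith
  · exact absurd (hxy.trans hyd) hxd
  · have := monotoneOn_pmProfile k (hright hx.2 (not_le.1 hxd).le)
      (hright hy.2 (not_le.1 hyd).le) (by gcongr)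
    gcongr
end

section
/- Fix d ∈ (0,1) and an integer k ≥ 2. Let p_L(ω) = (−1)^k ((k+1)/d^{k+1}) (ω − d)^{k+1} (ω + d/(k+1)) + d and p_R(ω) = −((k+1)/(1−d)^{k+1}) (ω − d)^{k+1} (ω + (d − (k+2))/(k+1)) + d be the left and right polynomial pieces of the WENO-PM mapping function. Then the derivative of p_L at ω = 0 equals 0 and the derivative of p_R at ω = 1 equals 0. -/
theorem hasDerivAt_const_mul_sub_pow_mul_add (A c d : ℝ) (k : ℕ) (x : ℝ) :
    HasDerivAt (fun ω : ℝ => A * (ω - d) ^ (k + 1) * (ω + c) + d)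
      (A * (x - d) ^ k * (((k : ℝ) + 1) * (x + c) + (x - d))) x := by
  have h := (((((hasDerivAt_id' x).sub_const d).fun_pow (k + 1)).const_mul A).fun_mul
    ((hasDerivAt_id' x).add_const c)).add_const d
  refine h.congr_deriv ?_
  push_cast [Nat.add_sub_cancel]
  ring

theorem gPM_endpoint_derivs_vanish (d : ℝ) (hd0 : 0 < d) (hd1 : d < 1) (k : ℕ) (hk : 2 ≤ k) :
    deriv (pL d k) 0 = 0 ∧ deriv (pR d k) 1 = 0 := by
  have hk1 : (k : ℝ) + 1 ≠ 0 := by positivity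
  refine ⟨(hasDerivAt_const_mul_sub_pow_mul_add _ _ d k 0).deriv.trans ?_,
    (hasDerivAt_const_mul_sub_pow_mul_add _ _ d k 1).deriv.trans ?_⟩
  · refine mul_eq_zero_of_right _ ?_
    field_simp
    ring
  · refine mul_eq_zero_of_right _ ?_
    field_simp
    ring
end

section
/- Fix a positive integer k and reals δ > 0, A > 0, and let sgm(x, δ, A) be the signum-like function. Then the function x ↦ sgm(x, δ, A) is monotone nondecreasing on all of ℝ. -/
/-- The signum-like function. -/
noncomputable def sgm (k : ℕ) (δ A x : ℝ) : ℝ :=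
  if δ ≤ |x| then x / |x|
  else x / ((A * (δ ^ 2 - x ^ 2)) ^ (k + 3) + |x|)

theorem sgm_neg (k : ℕ) (δ A x : ℝ) : sgm k δ A (-x) = -sgm k δ A x := by
  unfold sgm
  rw [abs_neg, neg_sq]
  split_ifs <;> exact neg_div _ _

theorem sgm_monotoneOn_nonneg (k : ℕ) {δ A : ℝ} (hδ : 0 < δ) (hA : 0 < A) :
    MonotoneOn (sgm k δ A) (Set.Ici 0) := by
  intro x hx y hy hxy
  rw [Set.mem_Ici] at hx hy
  have base_pos : ∀ {z : ℝ}, 0 ≤ z → z < δ → 0 < A * (δ ^ 2 - z ^ 2) := fun hz hzδ =>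
    mul_pos hA (sub_pos.2 (pow_lt_pow_left₀ hzδ hz two_ne_zero))
  simp only [sgm, abs_of_nonneg hx, abs_of_nonneg hy]
  rcases le_or_gt δ y with hyδ | hyδ
  · rw [if_pos hyδ, div_self (hδ.trans_le hyδ).ne']
    split_ifs with hxδ
    · exact div_self_le_one x
    · have hpos := pow_pos (base_pos hx (not_le.1 hxδ)) (k + 3)
      exact div_le_one_of_le₀ (by linarith) (by linarith)
  · have hxδ := hxy.trans_lt hyδ
    rw [if_neg hxδ.not_ge, if_neg hyδ.not_ge]
    have hpx := pow_pos (base_pos hx hxδ) (k + 3)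
    have hpy := pow_pos (base_pos hy hyδ) (k + 3)
    have hanti : (A * (δ ^ 2 - y ^ 2)) ^ (k + 3) ≤ (A * (δ ^ 2 - x ^ 2)) ^ (k + 3) :=
      pow_le_pow_left₀ (base_pos hy hyδ).le (by gcongr) _
    rw [div_le_div_iff₀ (by linarith) (by linarith)]
    linarith [mul_le_mul hxy hanti hpy.le hy]

theorem sgm_monotone (k : ℕ) (hk : 1 ≤ k) (δ A : ℝ) (hδ : 0 < δ) (hA : 0 < A) :
    Monotone (sgm k δ A) :=
  monotone_of_odd_of_monotoneOn_nonneg (sgm_neg k δ A) (sgm_monotoneOn_nonneg k hδ hA)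
end

section
/- Fix d ∈ (0,1), a positive integer k, A > 0, CFS ∈ (0, d); set ĈFS = 1 − ((1 − d)/d)·CFS and let δ > 0 satisfy δ < min{CFS, d − CFS, (1 − d)(1 − CFS/d), ((1 − d)/d)·CFS}. Let g^ACM be the WENO-ACM mapping function. Then g^ACM(ω) = 0 for every ω ∈ [0, CFS − δ], g^ACM(ω) = d for every ω ∈ [CFS + δ, ĈFS − δ], and g^ACM(ω) = 1 for every ω ∈ [ĈFS + δ, 1]. In particular, g^ACM is constant on a neighborhood of its fixed point d within [0,1], so all its derivatives vanish there, and it is constant near the endpoints 0 and 1 within [0,1], so its one-sided first derivatives at 0 and 1 vanish. -/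
/-- The right-side splicing point of the WENO-ACM mapping function. -/
noncomputable def CFSbar (d CFS : ℝ) : ℝ := 1 - (1 - d) / d * CFS

/-- The WENO-ACM mapping function. -/
noncomputable def gACM (d : ℝ) (k : ℕ) (A CFS δ : ℝ) (ω : ℝ) : ℝ :=
  if ω ≤ d then d / 2 * sgm k δ A (ω - CFS) + d / 2
  else (1 - d) / 2 * sgm k δ A (ω - CFSbar d CFS) + (1 + d) / 2

theorem sgm_of_le {δ x : ℝ} (hδ : 0 < δ) (hx : δ ≤ x) (k : ℕ) (A : ℝ) : sgm k δ A x = 1 := by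
  have hx0 : 0 < x := hδ.trans_le hx
  rw [sgm, abs_of_pos hx0, if_pos hx, div_self hx0.ne']

theorem sgm_of_le_neg {δ x : ℝ} (hδ : 0 < δ) (hx : x ≤ -δ) (k : ℕ) (A : ℝ) :
    sgm k δ A x = -1 := by
  have hx0 : x < 0 := by linarith
  rw [sgm, abs_of_neg hx0, if_pos (by linarith), div_neg, div_self hx0.ne]

theorem gACM_locally_constant (d : ℝ) (hd0 : 0 < d) (hd1 : d < 1) (k : ℕ) (hk : 1 ≤ k)
    (A CFS δ : ℝ) (hA : 0 < A) (hc0 : 0 < CFS) (hcd : CFS < d) (hδ0 : 0 < δ)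
    (hδ : δ < min CFS (min (d - CFS) (min ((1 - d) * (1 - CFS / d)) ((1 - d) / d * CFS)))) :
    (∀ ω ∈ Set.Icc (0 : ℝ) (CFS - δ), gACM d k A CFS δ ω = 0) ∧
    (∀ ω ∈ Set.Icc (CFS + δ) (CFSbar d CFS - δ), gACM d k A CFS δ ω = d) ∧
    (∀ ω ∈ Set.Icc (CFSbar d CFS + δ) 1, gACM d k A CFS δ ω = 1) ∧
    (∀ n : ℕ, 1 ≤ n → iteratedDeriv n (gACM d k A CFS δ) d = 0) ∧
    derivWithin (gACM d k A CFS δ) (Set.Icc (0 : ℝ) 1) 0 = 0 ∧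
    derivWithin (gACM d k A CFS δ) (Set.Icc (0 : ℝ) 1) 1 = 0 := by
  obtain ⟨h₁, h₂, h₃, h₄⟩ :
      δ < CFS ∧ δ < d - CFS ∧ δ < (1 - d) * (1 - CFS / d) ∧ δ < (1 - d) / d * CFS := by
    simpa only [lt_min_iff] using hδ
  have hbar : CFSbar d CFS - d = (1 - d) * (1 - CFS / d) := by
    rw [CFSbar]
    ring
  have hbar' : 1 - CFSbar d CFS = (1 - d) / d * CFS := by
    rw [CFSbar]
    ring
  have left : ∀ ω ≤ CFS - δ, gACM d k A CFS δ ω = 0 := by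
    intro ω hω
    rw [gACM, if_pos (by linarith), sgm_of_le_neg hδ0 (by linarith)]
    ring
  have middle : ∀ ω ∈ Set.Icc (CFS + δ) (CFSbar d CFS - δ), gACM d k A CFS δ ω = d := by
    rintro ω ⟨hl, hr⟩
    rw [gACM]
    split_ifs
    · rw [sgm_of_le hδ0 (by linarith)]
      ring
    · rw [sgm_of_le_neg hδ0 (by linarith)]
      ring
  have right : ∀ ω, CFSbar d CFS + δ ≤ ω → gACM d k A CFS δ ω = 1 := by
    intro ω hω
    rw [gACM, if_neg (by linarith), sgm_of_le hδ0 (by linarith)]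
    ring
  refine ⟨fun ω hω => left ω hω.2, middle, fun ω hω => right ω hω.1, fun n hn => ?_, ?_, ?_⟩
  · have h : gACM d k A CFS δ =ᶠ[nhds d] fun _ => d := by
      filter_upwards [Icc_mem_nhds (by linarith : CFS + δ < d)
        (by linarith : d < CFSbar d CFS - δ)] with ω hω using middle ω hω
    rw [h.iteratedDeriv_eq n, iteratedDeriv_const, if_neg (by lia)]
  · have h : gACM d k A CFS δ =ᶠ[nhds 0] fun _ => 0 := by
      filter_upwards [Iic_mem_nhds (by linarith : 0 < CFS - δ)] with ω hω using left ω hω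
    rw [h.derivWithin_eq_of_nhds, derivWithin_fun_const, Pi.zero_apply]
  · have h : gACM d k A CFS δ =ᶠ[nhds 1] fun _ => 1 := by
      filter_upwards [Ici_mem_nhds (by linarith : CFSbar d CFS + δ < 1)] with ω hω
        using right ω hω
    rw [h.derivWithin_eq_of_nhds, derivWithin_fun_const, Pi.zero_apply]
end
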